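/- There exists a finite set Z of points in the complex projective plane ℙ², not contained in a conic, whose radical homogeneous ideal I satisfies, for some integer m ≥ 1, α(I^(m+k)) = α(I^(m)) + 2k for k = 1, 2, 3. (Thus the hypothesis of four consecutive differences equal to 2 in Theorem B cannot be weakened to three.) -/

import Mathlib

open scoped LinearAlgebra.Projectivization

/-- A polynomial `F` vanishes to order at least `m` at the (affine representative) point
`v`: all iterated partial derivatives of order `≤ m - 1` (i.e. of order `< m`) vanish at `v`. -/
def VanishesToOrder (m : ℕ) (F : MvPolynomial (Fin 3) ℂ) (v : Fin 3 → ℂ) : Prop :=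
  ∀ k : ℕ, k < m → ∀ d : Fin k → Fin 3,
    MvPolynomial.eval v ((List.ofFn d).foldl (fun p i => MvPolynomial.pderiv i p) F) = 0

/-- The `m`-th symbolic power of the (radical) ideal of a set `Z` of points of `ℙ²`:
all polynomials vanishing to order at least `m` at every point of `Z`. -/
def symbolicPower (Z : Set (ℙ ℂ (Fin 3 → ℂ))) (m : ℕ) : Set (MvPolynomial (Fin 3) ℂ) :=
  {F | ∀ P ∈ Z, ∀ (v : Fin 3 → ℂ) (hv : v ≠ 0),
    Projectivization.mk ℂ v hv = P → VanishesToOrder m F v}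

/-- The initial degree `α` of a set of polynomials: the least `t` such that the set contains
a nonzero homogeneous polynomial of degree `t`. -/
noncomputable def initialDegree (S : Set (MvPolynomial (Fin 3) ℂ)) : ℕ :=
  sInf {t | ∃ F ∈ S, F ≠ 0 ∧ F.IsHomogeneous t}

/-- The Waldschmidt constant `α̂(I) = inf_{m ≥ 1} α(I^(m))/m` of the radical ideal of `Z`. -/
noncomputable def waldschmidt (Z : Set (ℙ ℂ (Fin 3 → ℂ))) : ℝ :=
  ⨅ m : ℕ+, (initialDegree (symbolicPower Z (m : ℕ)) : ℝ) / ((m : ℕ) : ℝ)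

/-- A (homogeneous equation of a) line in `ℙ²`: a nonzero homogeneous polynomial of degree 1. -/
def IsLine (L : MvPolynomial (Fin 3) ℂ) : Prop := L ≠ 0 ∧ L.IsHomogeneous 1

/-- The point `x ∈ ℙ²` lies on the line (or curve) with equation `L`. -/
def MemLine (L : MvPolynomial (Fin 3) ℂ) (x : ℙ ℂ (Fin 3 → ℂ)) : Prop :=
  ∀ (v : Fin 3 → ℂ) (hv : v ≠ 0), Projectivization.mk ℂ v hv = x → MvPolynomial.eval v L = 0

/-- Three points of `ℙ²` are collinear if some line contains all of them. -/
def Collin (x y z : ℙ ℂ (Fin 3 → ℂ)) : Prop :=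
  ∃ M, IsLine M ∧ MemLine M x ∧ MemLine M y ∧ MemLine M z

/-- `Z` is contained in a conic: the zero set of a nonzero homogeneous polynomial of degree 2
(possibly degenerate). -/
def ContainedInConic (Z : Set (ℙ ℂ (Fin 3 → ℂ))) : Prop :=
  ∃ F : MvPolynomial (Fin 3) ℂ, F ≠ 0 ∧ F.IsHomogeneous 2 ∧ ∀ x ∈ Z, MemLine F x

open MvPolynomial

/-! ### Vanishing order of products -/

theorem vanishesToOrder_zero (F : MvPolynomial (Fin 3) ℂ) (v : Fin 3 → ℂ) :
    VanishesToOrder 0 F v := fun _ hk => absurd hk (Nat.not_lt_zero _)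

theorem vanishesToOrder_succ {m : ℕ} {F : MvPolynomial (Fin 3) ℂ} {v : Fin 3 → ℂ} :
    VanishesToOrder (m + 1) F v ↔
      eval v F = 0 ∧ ∀ i, VanishesToOrder m (pderiv i F) v := by
  constructor
  · intro h
    refine ⟨by simpa using h 0 (Nat.succ_pos m) Fin.elim0, fun i k hk d => ?_⟩
    simpa [List.ofFn_succ] using h (k + 1) (by omega) (Fin.cons i d)
  · rintro ⟨h0, h⟩ k hk d
    cases k with
    | zero => simpa using h0
    | succ k => simpa [List.ofFn_succ] using h (d 0) k (by omega) (fun j => d j.succ)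

theorem VanishesToOrder.mono {m n : ℕ} {F : MvPolynomial (Fin 3) ℂ} {v : Fin 3 → ℂ}
    (h : VanishesToOrder n F v) (hmn : m ≤ n) : VanishesToOrder m F v :=
  fun k hk d => h k (hk.trans_le hmn) d

theorem VanishesToOrder.add {m : ℕ} {F G : MvPolynomial (Fin 3) ℂ} {v : Fin 3 → ℂ}
    (hF : VanishesToOrder m F v) (hG : VanishesToOrder m G v) :
    VanishesToOrder m (F + G) v := by
  induction m generalizing F G with
  | zero => exact vanishesToOrder_zero _ _
  | succ m ih =>
    rw [vanishesToOrder_succ] at hF hG ⊢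
    refine ⟨by simp [hF.1, hG.1], fun i => ?_⟩
    rw [map_add]
    exact ih (hF.2 i) (hG.2 i)

theorem VanishesToOrder.mul_left {m : ℕ} {G : MvPolynomial (Fin 3) ℂ} {v : Fin 3 → ℂ}
    (hG : VanishesToOrder m G v) (H : MvPolynomial (Fin 3) ℂ) :
    VanishesToOrder m (H * G) v := by
  induction m generalizing G H with
  | zero => exact vanishesToOrder_zero _ _
  | succ m ih =>
    have hG' := vanishesToOrder_succ.1 hG
    refine vanishesToOrder_succ.2 ⟨by simp [hG'.1], fun i => ?_⟩
    rw [pderiv_mul]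
    exact (ih (hG.mono m.le_succ) _).add (ih (hG'.2 i) _)

theorem VanishesToOrder.mul_of_eval_eq_zero {m : ℕ} {L G : MvPolynomial (Fin 3) ℂ}
    {v : Fin 3 → ℂ} (hL : eval v L = 0) (hG : VanishesToOrder m G v) :
    VanishesToOrder (m + 1) (L * G) v := by
  induction m generalizing G with
  | zero => exact vanishesToOrder_succ.2 ⟨by simp [hL], fun i => vanishesToOrder_zero _ _⟩
  | succ m ih =>
    refine vanishesToOrder_succ.2 ⟨by simp [hL], fun i => ?_⟩
    rw [pderiv_mul]
    exact (hG.mul_left _).add (ih ((vanishesToOrder_succ.1 hG).2 i))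

/-! ### The Taylor expansion at a point -/

/-- The expansion `F(v + X • w)`, as a polynomial in `X`, along the generic direction `w`. -/
noncomputable def taylorAt (v : Fin 3 → ℂ) :
    MvPolynomial (Fin 3) ℂ →ₐ[ℂ] Polynomial (MvPolynomial (Fin 3) ℂ) :=
  aeval fun i => Polynomial.C (C (v i)) + Polynomial.X * Polynomial.C (X i)

/-- `F` vanishes to order at least `m` at `v`, in terms of the Taylor expansion at `v`. -/
def TaylorOrder (m : ℕ) (F : MvPolynomial (Fin 3) ℂ) (v : Fin 3 → ℂ) : Prop :=
  Polynomial.X ^ m ∣ taylorAt v F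

theorem taylorAt_C (v : Fin 3 → ℂ) (a : ℂ) : taylorAt v (C a) = Polynomial.C (C a) := by
  rw [← algebraMap_eq, AlgHom.commutes]
  rfl

theorem taylorAt_X (v : Fin 3 → ℂ) (i : Fin 3) :
    taylorAt v (X i) = Polynomial.C (C (v i)) + Polynomial.X * Polynomial.C (X i) := by
  simp [taylorAt]

theorem derivative_taylorAt (v : Fin 3 → ℂ) (F : MvPolynomial (Fin 3) ℂ) :
    Polynomial.derivative (taylorAt v F) =
      ∑ i, Polynomial.C (X i) * taylorAt v (pderiv i F) := by
  induction F using MvPolynomial.induction_on with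
  | C a => simp
  | add p q hp hq => simp only [map_add, hp, hq, mul_add, Finset.sum_add_distrib]
  | mul_X p j hp =>
    have h : ∀ i, taylorAt v (pderiv i (p * X j)) =
        taylorAt v (pderiv i p) * taylorAt v (X j) +
          taylorAt v p * (Pi.single j 1 : Fin 3 → Polynomial (MvPolynomial (Fin 3) ℂ)) i := by
      intro i
      rw [pderiv_mul, pderiv_X, map_add, map_mul, map_mul]
      congr 2
      by_cases hij : j = i
      · subst hij; simp
      · simp [hij, Ne.symm hij]
    have hX : Polynomial.derivative (taylorAt v (X j)) = Polynomial.C (X j) := by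
      simp [taylorAt_X]
    rw [map_mul, Polynomial.derivative_mul, hp, hX, Finset.sum_mul]
    simp only [h, mul_add, Finset.sum_add_distrib]
    refine congrArg₂ (· + ·) ?_ ?_
    · exact Finset.sum_congr rfl fun i _ => by ring
    · rw [Finset.sum_eq_single j (fun i _ hi => by simp [hi]) (by simp)]
      simp [mul_comm]

theorem coeff_zero_taylorAt (v : Fin 3 → ℂ) (F : MvPolynomial (Fin 3) ℂ) :
    (taylorAt v F).coeff 0 = C (eval v F) := by
  induction F using MvPolynomial.induction_on with
  | C a => simp
  | add p q hp hq => simp [hp, hq]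
  | mul_X p j hp => simp [hp, taylorAt_X, Polynomial.mul_coeff_zero]

theorem VanishesToOrder.taylorOrder {m : ℕ} {F : MvPolynomial (Fin 3) ℂ} {v : Fin 3 → ℂ}
    (h : VanishesToOrder m F v) : TaylorOrder m F v := by
  induction m generalizing F with
  | zero => simp [TaylorOrder]
  | succ m ih =>
    rw [vanishesToOrder_succ] at h
    have hd : Polynomial.X ^ m ∣ Polynomial.derivative (taylorAt v F) := by
      rw [derivative_taylorAt]
      exact Finset.dvd_sum fun i _ => (ih (h.2 i)).mul_left _
    rw [TaylorOrder, Polynomial.X_pow_dvd_iff]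
    rw [Polynomial.X_pow_dvd_iff] at hd
    intro k hk
    cases k with
    | zero => rw [coeff_zero_taylorAt, h.1, C_0]
    | succ k =>
      have := hd k (by omega)
      rw [Polynomial.coeff_derivative] at this
      exact (mul_eq_zero.1 this).resolve_right (by exact_mod_cast k.succ_ne_zero)

/-! ### Linear forms -/

/-- The linear form with coefficients `l`. -/
noncomputable def linearForm (l : Fin 3 → ℂ) : MvPolynomial (Fin 3) ℂ := ∑ i, C (l i) * X i

theorem eval_linearForm (l v : Fin 3 → ℂ) : eval v (linearForm l) = ∑ i, l i * v i := by
  simp [linearForm]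

theorem isHomogeneous_linearForm (l : Fin 3 → ℂ) : (linearForm l).IsHomogeneous 1 :=
  IsHomogeneous.sum _ _ _ fun i _ => by
    simpa using (isHomogeneous_C (Fin 3) (l i)).mul (isHomogeneous_X ℂ i)

theorem linearForm_ne_zero {l : Fin 3 → ℂ} (hl : l ≠ 0) : linearForm l ≠ 0 := by
  intro h
  refine hl (funext fun i => ?_)
  have := eval_linearForm l (Pi.single i 1)
  simpa [h, Pi.single_apply] using this.symm

theorem taylorAt_linearForm (l v : Fin 3 → ℂ) :
    taylorAt v (linearForm l) =
      Polynomial.C (C (∑ i, l i * v i)) + Polynomial.X * Polynomial.C (linearForm l) := by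
  simp only [linearForm, map_sum, map_mul, taylorAt_C, taylorAt_X, Finset.mul_sum,
    ← Finset.sum_add_distrib]
  exact Finset.sum_congr rfl fun i _ => by ring

theorem not_X_dvd_C {f : MvPolynomial (Fin 3) ℂ} (hf : f ≠ 0) :
    ¬ (Polynomial.X : Polynomial (MvPolynomial (Fin 3) ℂ)) ∣ Polynomial.C f := by
  simpa [Polynomial.X_dvd_iff] using hf

theorem TaylorOrder.of_linearForm_mul {m : ℕ} {l v : Fin 3 → ℂ} {G : MvPolynomial (Fin 3) ℂ}
    (hl : ∑ i, l i * v i ≠ 0) (h : TaylorOrder m (linearForm l * G) v) : TaylorOrder m G v := by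
  rw [TaylorOrder, map_mul] at h
  refine Polynomial.prime_X.pow_dvd_of_dvd_mul_left m ?_ h
  rw [Polynomial.X_dvd_iff, coeff_zero_taylorAt, eval_linearForm]
  exact (map_ne_zero_iff C (C_injective _ _)).2 hl

theorem TaylorOrder.sub_one_of_linearForm_mul {m : ℕ} {l v : Fin 3 → ℂ}
    {G : MvPolynomial (Fin 3) ℂ} (hl : l ≠ 0) (h : TaylorOrder m (linearForm l * G) v) :
    TaylorOrder (m - 1) G v := by
  by_cases hv : ∑ i, l i * v i = 0
  · cases m with
    | zero => simp [TaylorOrder]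
    | succ m =>
      rw [TaylorOrder, map_mul, taylorAt_linearForm, hv, C_0, Polynomial.C_0, zero_add,
        mul_assoc, pow_succ', mul_dvd_mul_iff_left Polynomial.X_ne_zero] at h
      exact Polynomial.prime_X.pow_dvd_of_dvd_mul_left m (not_X_dvd_C (linearForm_ne_zero hl)) h
  · exact (pow_dvd_pow _ (m.sub_le 1)).trans (h.of_linearForm_mul hv)

/-! ### Restriction to a line -/

/-- The restriction of `F` to the line through `u` and `v`, parametrised by `u + X (v - u)`. -/
noncomputable def restrictLine (u v : Fin 3 → ℂ) : MvPolynomial (Fin 3) ℂ →ₐ[ℂ] Polynomial ℂ :=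
  aeval fun i => Polynomial.C (u i) + Polynomial.X * Polynomial.C (v i - u i)

theorem TaylorOrder.dvd_restrictLine {m : ℕ} {F : MvPolynomial (Fin 3) ℂ} {u v : Fin 3 → ℂ}
    (s : ℂ) (h : TaylorOrder m F fun i => u i + s * (v i - u i)) :
    (Polynomial.X - Polynomial.C s) ^ m ∣ restrictLine u v F := by
  let φ : Polynomial (MvPolynomial (Fin 3) ℂ) →+* Polynomial ℂ :=
    Polynomial.eval₂RingHom (Polynomial.C.comp (eval fun i => v i - u i))
      (Polynomial.X - Polynomial.C s)
  have hφ : φ.comp (taylorAt fun i => u i + s * (v i - u i)).toRingHom =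
      (restrictLine u v).toRingHom := by
    refine MvPolynomial.ringHom_ext (fun a => ?_) fun i => ?_
    · simp [φ, taylorAt, restrictLine]
    · simp [φ, taylorAt, restrictLine]
      ring
  have := map_dvd φ h
  rw [map_pow] at this
  have hF : φ (taylorAt (fun i => u i + s * (v i - u i)) F) = restrictLine u v F :=
    RingHom.congr_fun hφ F
  rw [hF] at this
  simpa [φ] using this

theorem eval_restrictLine (u v : Fin 3 → ℂ) (s : ℂ) (F : MvPolynomial (Fin 3) ℂ) :
    (restrictLine u v F).eval s = eval (fun i => u i + s * (v i - u i)) F := by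
  have h : (Polynomial.evalRingHom s).comp (restrictLine u v).toRingHom =
      eval (fun i => u i + s * (v i - u i)) := by
    refine MvPolynomial.ringHom_ext (fun a => ?_) fun i => ?_
    · simp [restrictLine]
    · simp [restrictLine]
  exact RingHom.congr_fun h F

theorem restrictLine_eq_zero {t a b c : ℕ} {F : MvPolynomial (Fin 3) ℂ} {u v : Fin 3 → ℂ}
    (hF : F.IsHomogeneous t) (ha : TaylorOrder a F u) (hb : TaylorOrder b F v)
    (hc : TaylorOrder c F fun i => u i + 1 / 2 * (v i - u i)) (ht : t < a + b + c) :
    restrictLine u v F = 0 := by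
  have ha' := TaylorOrder.dvd_restrictLine (u := u) (v := v) (F := F) (m := a) 0 (by simpa using ha)
  have hb' := TaylorOrder.dvd_restrictLine (u := u) (v := v) (F := F) (m := b) 1 (by simpa using hb)
  have hc' := hc.dvd_restrictLine
  have hcop : ∀ {x y : ℂ} (k n : ℕ), x ≠ y →
      IsCoprime ((Polynomial.X - Polynomial.C x) ^ k) ((Polynomial.X - Polynomial.C y) ^ n) :=
    fun k n hxy => (Polynomial.isCoprime_X_sub_C_of_isUnit_sub (sub_ne_zero.2 hxy).isUnit).pow
  have hdvd := ((hcop a c (by norm_num)).mul_left (hcop b c (by norm_num))).mul_dvd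
    ((hcop a b (by norm_num)).mul_dvd ha' hb') hc'
  refine Polynomial.eq_zero_of_dvd_of_natDegree_lt hdvd ?_
  have hdeg : (restrictLine u v F).natDegree ≤ t * 1 :=
    aeval_natDegree_le F hF.totalDegree_le _ fun i => by compute_degree
  refine hdeg.trans_lt ?_
  rw [Polynomial.natDegree_mul, Polynomial.natDegree_mul]
  · simpa only [Polynomial.natDegree_pow, Polynomial.natDegree_X_sub_C, mul_one] using ht
  all_goals
    first
    | exact pow_ne_zero _ (Polynomial.X_sub_C_ne_zero _)
    | exact mul_ne_zero (pow_ne_zero _ (Polynomial.X_sub_C_ne_zero _))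
        (pow_ne_zero _ (Polynomial.X_sub_C_ne_zero _))

theorem eval_smul_of_isHomogeneous {t : ℕ} {F : MvPolynomial (Fin 3) ℂ} (hF : F.IsHomogeneous t)
    (r : ℂ) (v : Fin 3 → ℂ) : eval (r • v) F = r ^ t * eval v F := by
  rw [eval_eq, eval_eq, Finset.mul_sum]
  refine Finset.sum_congr rfl fun d hd => ?_
  rw [hF.degree_eq_sum_deg_support hd, ← Finset.prod_pow_eq_pow_sum]
  simp only [Pi.smul_apply, smul_eq_mul, mul_pow, Finset.prod_mul_distrib]
  ring

/-- If `F` restricts to zero on the line through `u` and `v`, then it is divisible by the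
equation `L` of that line. Here `A`, `B`, `L` are coordinates in the frame `u`, `v`, `n`. -/
theorem dvd_of_restrictLine_eq_zero {t : ℕ} {F A B L : MvPolynomial (Fin 3) ℂ}
    {u v n : Fin 3 → ℂ} (hF : F.IsHomogeneous t) (hAB : A + B ≠ 0)
    (hX : ∀ i, X i = A * C (u i) + B * C (v i) + L * C (n i))
    (h : restrictLine u v F = 0) : L ∣ F := by
  have h0 : aeval (fun i => A * C (u i) + B * C (v i)) F = 0 := by
    refine (mul_eq_zero.1 (?_ : (A + B) * _ = 0)).resolve_left hAB
    refine MvPolynomial.funext fun x => ?_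
    have hx : eval x (aeval (fun i => A * C (u i) + B * C (v i)) F) =
        eval (fun i => eval x A * u i + eval x B * v i) F := by
      have h : (eval x).comp (aeval (fun i => A * C (u i) + B * C (v i))).toRingHom =
          eval (fun i => eval x A * u i + eval x B * v i) := by
        refine MvPolynomial.ringHom_ext (fun a => ?_) fun i => ?_ <;> simp
      exact RingHom.congr_fun h F
    rw [map_mul, map_add, hx, map_zero]
    by_cases hs : eval x A + eval x B = 0
    · rw [hs, zero_mul]
    · have := eval_restrictLine u v (eval x B / (eval x A + eval x B)) F
      rw [h, Polynomial.eval_zero] at this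
      have hscale : (fun i => eval x A * u i + eval x B * v i) = (eval x A + eval x B) •
          fun i => u i + eval x B / (eval x A + eval x B) * (v i - u i) := by
        funext i
        simp only [Pi.smul_apply, smul_eq_mul]
        field_simp
        ring
      rw [hscale, eval_smul_of_isHomogeneous hF, ← this]
      simp
  rw [← Ideal.mem_span_singleton, ← Ideal.Quotient.eq_zero_iff_mem]
  set q := Ideal.Quotient.mkₐ ℂ (Ideal.span {L}) with hq
  have hL : q L = 0 := Ideal.Quotient.eq_zero_iff_mem.2 (Ideal.mem_span_singleton_self L)
  have hcomp : q = q.comp (aeval fun i => A * C (u i) + B * C (v i)) := by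
    refine MvPolynomial.algHom_ext fun i => ?_
    rw [AlgHom.comp_apply, aeval_X, hX i, map_add q _ (L * _), map_mul q L, hL, zero_mul, add_zero]
  change q F = 0
  rw [hcomp, AlgHom.comp_apply, h0, map_zero]

theorem exists_eq_linearForm_mul {t : ℕ} {F : MvPolynomial (Fin 3) ℂ} {l : Fin 3 → ℂ}
    (hF0 : F ≠ 0) (hF : F.IsHomogeneous t) (h : linearForm l ∣ F) :
    ∃ s G, t = s + 1 ∧ G ≠ 0 ∧ G.IsHomogeneous s ∧ F = linearForm l * G := by
  obtain ⟨G, rfl⟩ := h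
  have hG : G ≠ 0 := right_ne_zero_of_mul hF0
  have hl : linearForm l ≠ 0 := left_ne_zero_of_mul hF0
  have ht := hF.totalDegree hF0
  rw [totalDegree_mul_of_isDomain hl hG, (isHomogeneous_linearForm l).totalDegree hl] at ht
  refine ⟨G.totalDegree, G, by omega, hG, ?_, rfl⟩
  let := gradedAlgebra (σ := Fin 3) (R := ℂ)
  have h := DirectSum.coe_decompose_mul_add_of_left_mem (homogeneousSubmodule (Fin 3) ℂ)
    (j := G.totalDegree) (b := G) (isHomogeneous_linearForm l)
  rw [DirectSum.decompose_of_mem_same _ (by rwa [ht, mem_homogeneousSubmodule])] at h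
  have hG' := ((DirectSum.decompose (homogeneousSubmodule (Fin 3) ℂ) G) G.totalDegree).2
  rwa [← mul_left_cancel₀ hl h, mem_homogeneousSubmodule] at hG'

theorem exists_quotient_of_restrictLine {t a b c : ℕ} {F A B : MvPolynomial (Fin 3) ℂ}
    {l u v w n : Fin 3 → ℂ} (hF0 : F ≠ 0) (hF : F.IsHomogeneous t) (hAB : A + B ≠ 0)
    (hX : ∀ i, X i = A * C (u i) + B * C (v i) + linearForm l * C (n i))
    (hw : ∀ i, w i = u i + 1 / 2 * (v i - u i))
    (ha : TaylorOrder a F u) (hb : TaylorOrder b F v) (hc : TaylorOrder c F w)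
    (ht : t < a + b + c) :
    ∃ s G, t = s + 1 ∧ G ≠ 0 ∧ G.IsHomogeneous s ∧ F = linearForm l * G := by
  obtain rfl : w = fun i => u i + 1 / 2 * (v i - u i) := funext hw
  exact exists_eq_linearForm_mul hF0 hF
    (dvd_of_restrictLine_eq_zero hF hAB hX (restrictLine_eq_zero hF ha hb hc ht))

/-! ### The vertices of a triangle together with a point on each side -/

/-- The vertices of the coordinate triangle. -/
noncomputable def vertex (i : Fin 3) : Fin 3 → ℂ := fun j => if j = i then 1 else 0

/-- The midpoint of the side of the coordinate triangle opposite to the vertex `i`. -/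
noncomputable def sideMidpoint (i : Fin 3) : Fin 3 → ℂ := fun j => if j = i then 0 else 1 / 2

/-- There is a curve of degree at most `T` with multiplicity at least `a i` at the vertex `i` and
`b i` at the midpoint of the opposite side. -/
def HasCurve (T : ℕ) (a b : Fin 3 → ℕ) : Prop :=
  ∃ t ≤ T, ∃ F : MvPolynomial (Fin 3) ℂ, F ≠ 0 ∧ F.IsHomogeneous t ∧
    (∀ i, TaylorOrder (a i) F (vertex i)) ∧ ∀ i, TaylorOrder (b i) F (sideMidpoint i)

/-- By Bézout, a curve of low degree contains the side opposite to the vertex `i`. -/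
theorem HasCurve.remove_side {T : ℕ} {a b : Fin 3 → ℕ} (h : HasCurve T a b) (i : Fin 3)
    (hT : T < a (i + 1) + a (i + 2) + b i) :
    1 ≤ T ∧ HasCurve (T - 1) (fun j => if j = i then a j else a j - 1)
      (fun j => if j = i then b j - 1 else b j) := by
  obtain ⟨t, htT, F, hF0, hF, ha, hb⟩ := h
  have hl : vertex i ≠ 0 := fun h => by simpa [vertex] using congrFun h i
  obtain ⟨s, G, rfl, hG0, hG, rfl⟩ := exists_quotient_of_restrictLine (A := X (i + 1))
    (B := X (i + 2)) (l := vertex i) (n := vertex i) hF0 hF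
    (fun h => by
      have := congrArg (eval fun _ => (1 : ℂ)) h
      norm_num at this)
    (by fin_cases i <;> intro j <;> fin_cases j <;> simp [vertex, linearForm])
    (by fin_cases i <;> intro j <;> fin_cases j <;> simp [vertex, sideMidpoint] <;> norm_num)
    (ha (i + 1)) (ha (i + 2)) (hb i) (by omega)
  refine ⟨by omega, s, by omega, G, hG0, hG, fun j => ?_, fun j => ?_⟩
  · dsimp only
    split_ifs with hj
    · exact (ha j).of_linearForm_mul (by simp [hj, vertex])
    · exact (ha j).sub_one_of_linearForm_mul hl
  · dsimp only
    split_ifs with hj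
    · exact (hb j).sub_one_of_linearForm_mul hl
    · exact (hb j).of_linearForm_mul (by
        simp only [vertex, ite_mul, one_mul, zero_mul, Finset.sum_ite_eq', Finset.mem_univ, if_true]
        simp [sideMidpoint, Ne.symm hj])

/-- By Bézout, a curve of low degree contains the line through the two side midpoints other than
the `i`-th one. -/
theorem HasCurve.remove_midline {T : ℕ} {a b : Fin 3 → ℕ} (h : HasCurve T a b) (i : Fin 3)
    (hT : T < b (i + 1) + b (i + 2)) :
    1 ≤ T ∧ HasCurve (T - 1) (fun j => a j - 1) (fun j => if j = i then b j else b j - 1) := by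
  obtain ⟨t, htT, F, hF0, hF, ha, hb⟩ := h
  have hl : (fun j => if j = i then -1 else 1 : Fin 3 → ℂ) ≠ 0 :=
    fun h => by simpa using congrFun h i
  obtain ⟨s, G, rfl, hG0, hG, rfl⟩ := exists_quotient_of_restrictLine
    (A := C 2 * X (i + 2)) (B := C 2 * X (i + 1)) (l := fun j => if j = i then -1 else 1)
    (n := fun j => if j = i then -1 else 0) (c := 0) hF0 hF
    (fun h => by
      have := congrArg (eval fun _ => (1 : ℂ)) h
      norm_num at this)
    (by
      have h2 : (C 2 * C 2⁻¹ : MvPolynomial (Fin 3) ℂ) = 1 := by rw [← C_mul]; simp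
      fin_cases i <;> intro j <;> fin_cases j <;>
        simp [sideMidpoint, linearForm, Fin.sum_univ_three] <;> grind)
    (fun _ => rfl) (hb (i + 1)) (hb (i + 2)) (by simp [TaylorOrder]) (by omega)
  refine ⟨by omega, s, by omega, G, hG0, hG,
    fun j => (ha j).sub_one_of_linearForm_mul hl, fun j => ?_⟩
  dsimp only
  split_ifs with hj
  · refine (hb j).of_linearForm_mul ?_
    subst hj
    fin_cases j <;> simp [sideMidpoint, Fin.sum_univ_three]
  · exact (hb j).sub_one_of_linearForm_mul hl

theorem not_hasCurve_one : ¬ HasCurve 2 (fun _ => 1) (fun _ => 1) := fun h =>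
  absurd (((h.remove_side 0 (by decide)).2.remove_side 1 (by decide)).2.remove_side 2
    (by decide)).1 (by decide)

theorem not_hasCurve_two : ¬ HasCurve 4 (fun _ => 2) (fun _ => 2) := fun h =>
  have h₁ := (((h.remove_side 0 (by decide)).2.remove_side 1 (by decide)).2.remove_side 2
    (by decide)).2
  absurd ((h₁.remove_midline 0 (by decide)).2.remove_midline 1 (by decide)).1 (by decide)

theorem not_hasCurve_three : ¬ HasCurve 6 (fun _ => 3) (fun _ => 3) := fun h =>
  have h₁ := (((h.remove_side 0 (by decide)).2.remove_side 1 (by decide)).2.remove_side 2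
    (by decide)).2
  have h₂ := (((h₁.remove_side 0 (by decide)).2.remove_side 1 (by decide)).2.remove_side 2
    (by decide)).2
  absurd (h₂.remove_side 0 (by decide)).1 (by decide)

theorem not_hasCurve_four : ¬ HasCurve 8 (fun _ => 4) (fun _ => 4) := fun h =>
  have h₁ := (((h.remove_side 0 (by decide)).2.remove_side 1 (by decide)).2.remove_side 2
    (by decide)).2
  have h₂ := (((h₁.remove_side 0 (by decide)).2.remove_side 1 (by decide)).2.remove_side 2
    (by decide)).2
  absurd (((h₂.remove_midline 2 (by decide)).2.remove_midline 0 (by decide)).2.remove_midline 1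
    (by decide)).1 (by decide)

/-- Integral representatives of the vertices and side midpoints of the coordinate triangle. -/
def trianglePoint : Fin 6 → Fin 3 → ℤ :=
  ![![1, 0, 0], ![0, 1, 0], ![0, 0, 1], ![0, 1, 1], ![1, 0, 1], ![1, 1, 0]]

theorem intCast_comp_ne_zero {p : Fin 3 → ℤ} (hp : p ≠ 0) : (fun i => (p i : ℂ)) ≠ 0 :=
  fun h => hp (funext fun i => by simpa using congrFun h i)

theorem trianglePoint_ne_zero (j : Fin 6) : (fun i => (trianglePoint j i : ℂ)) ≠ 0 :=
  intCast_comp_ne_zero (by revert j; decide)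

/-- The vertices and side midpoints of the coordinate triangle, as points of `ℙ²`. -/
def triangleSet : Set (ℙ ℂ (Fin 3 → ℂ)) :=
  Set.range fun j => Projectivization.mk ℂ (fun i => (trianglePoint j i : ℂ))
    (trianglePoint_ne_zero j)

theorem vanishesToOrder_smul_trianglePoint {m : ℕ} {F : MvPolynomial (Fin 3) ℂ}
    (hF : F ∈ symbolicPower triangleSet m) {r : ℂ} (hr : r ≠ 0) (j : Fin 6) {v : Fin 3 → ℂ}
    (hv : ∀ i, v i = r * trianglePoint j i) : VanishesToOrder m F v := by
  obtain rfl : v = r • fun i => (trianglePoint j i : ℂ) := funext hv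
  exact hF _ ⟨j, rfl⟩ _ (smul_ne_zero hr (trianglePoint_ne_zero j))
    ((Projectivization.mk_eq_mk_iff' ..).2 ⟨r, rfl⟩)

theorem hasCurve_of_mem_symbolicPower {m t T : ℕ} {F : MvPolynomial (Fin 3) ℂ}
    (hF : F ∈ symbolicPower triangleSet m) (hF0 : F ≠ 0) (ht : F.IsHomogeneous t) (htT : t ≤ T) :
    HasCurve T (fun _ => m) (fun _ => m) := by
  refine ⟨t, htT, F, hF0, ht, fun i => ?_, fun i => ?_⟩
  · refine (vanishesToOrder_smul_trianglePoint hF one_ne_zero (Fin.castAdd 3 i) ?_).taylorOrder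
    fin_cases i <;> intro j <;> fin_cases j <;> simp [vertex, trianglePoint]
  · refine (vanishesToOrder_smul_trianglePoint hF (r := 1 / 2) (by norm_num)
      (Fin.natAdd 3 i) ?_).taylorOrder
    fin_cases i <;> intro j <;> fin_cases j <;> simp [sideMidpoint, trianglePoint]

/-! ### Products of lines -/

/-- The product of the linear forms with the given integral coefficients. -/
noncomputable def lineProduct (Ls : List (Fin 3 → ℤ)) : MvPolynomial (Fin 3) ℂ :=
  (Ls.map fun l => linearForm fun i => (l i : ℂ)).prod

theorem lineProduct_ne_zero {Ls : List (Fin 3 → ℤ)} (h : ∀ l ∈ Ls, l ≠ 0) :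
    lineProduct Ls ≠ 0 := by
  refine List.prod_ne_zero fun h0 => ?_
  obtain ⟨l, hl, h0⟩ := List.mem_map.1 h0
  exact linearForm_ne_zero (intCast_comp_ne_zero (h l hl)) h0

theorem isHomogeneous_lineProduct (Ls : List (Fin 3 → ℤ)) :
    (lineProduct Ls).IsHomogeneous Ls.length := by
  induction Ls with
  | nil => exact isHomogeneous_one _ _
  | cons l Ls ih =>
    rw [List.length_cons, add_comm]
    exact (isHomogeneous_linearForm _).mul ih

theorem vanishesToOrder_lineProduct (Ls : List (Fin 3 → ℤ)) (p : Fin 3 → ℤ) (r : ℂ) :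
    VanishesToOrder (Ls.countP fun l => ∑ i, l i * p i = 0) (lineProduct Ls)
      (r • fun i => (p i : ℂ)) := by
  induction Ls with
  | nil => exact vanishesToOrder_zero _ _
  | cons l Ls ih =>
    by_cases hl : ∑ i, l i * p i = 0
    · rw [List.countP_cons_of_pos (by simpa using hl)]
      refine VanishesToOrder.mul_of_eval_eq_zero ?_ ih
      have hl' : ∑ i, (l i : ℂ) * p i = 0 := by exact_mod_cast hl
      simp only [eval_linearForm, Pi.smul_apply, smul_eq_mul, mul_left_comm _ r]
      rw [← Finset.mul_sum, hl', mul_zero]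
    · rw [List.countP_cons_of_neg (by simpa using hl)]
      exact ih.mul_left _

theorem lineProduct_mem_symbolicPower {m : ℕ} {Ls : List (Fin 3 → ℤ)}
    (h : ∀ j, m ≤ Ls.countP fun l => ∑ i, l i * trianglePoint j i = 0) :
    lineProduct Ls ∈ symbolicPower triangleSet m := by
  rintro _ ⟨j, rfl⟩ v hv hvj
  obtain ⟨r, rfl⟩ := (Projectivization.mk_eq_mk_iff' ..).1 hvj
  exact (vanishesToOrder_lineProduct Ls _ r).mono (h j)

theorem initialDegree_symbolicPower_triangleSet {m d : ℕ} (Ls : List (Fin 3 → ℤ))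
    (hlen : Ls.length = d + 1) (h0 : ∀ l ∈ Ls, l ≠ 0)
    (hm : ∀ j, m ≤ Ls.countP fun l => ∑ i, l i * trianglePoint j i = 0)
    (hd : ¬ HasCurve d (fun _ => m) (fun _ => m)) :
    initialDegree (symbolicPower triangleSet m) = d + 1 := by
  have hmem : d + 1 ∈ {t | ∃ F ∈ symbolicPower triangleSet m, F ≠ 0 ∧ F.IsHomogeneous t} :=
    ⟨_, lineProduct_mem_symbolicPower hm, lineProduct_ne_zero h0,
      hlen ▸ isHomogeneous_lineProduct Ls⟩
  refine le_antisymm (Nat.sInf_le hmem) (le_csInf ⟨_, hmem⟩ ?_)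
  rintro t ⟨F, hF, hF0, ht⟩
  by_contra! hlt
  exact hd (hasCurve_of_mem_symbolicPower hF hF0 ht (Nat.lt_succ_iff.1 hlt))

theorem not_containedInConic_triangleSet : ¬ ContainedInConic triangleSet := by
  rintro ⟨F, hF0, hF, hmem⟩
  refine not_hasCurve_one (hasCurve_of_mem_symbolicPower (fun P hP v hv hvP => ?_) hF0 hF le_rfl)
  exact vanishesToOrder_succ.2 ⟨hmem P hP v hv hvP, fun _ => vanishesToOrder_zero _ _⟩

/-- There is a finite planar point set `Z`, not contained in a conic, whose radical ideal has
three consecutive first differences of the initial sequence equal to `2`: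
`α(I^(m+k)) = α(I^(m)) + 2k` for `k = 1, 2, 3`. -/
theorem exists_three_consecutive_differences_two :
    ∃ Z : Set (ℙ ℂ (Fin 3 → ℂ)), Z.Finite ∧ ¬ ContainedInConic Z ∧
      ∃ m : ℕ, 1 ≤ m ∧ ∀ k : ℕ, 1 ≤ k → k ≤ 3 →
        initialDegree (symbolicPower Z (m + k)) =
          initialDegree (symbolicPower Z m) + 2 * k := by
  have h1 : initialDegree (symbolicPower triangleSet 1) = 3 :=
    initialDegree_symbolicPower_triangleSet [![1, 0, 0], ![0, 1, 0], ![0, 0, 1]]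
      rfl (by decide) (by decide) not_hasCurve_one
  have h2 : initialDegree (symbolicPower triangleSet 2) = 5 :=
    initialDegree_symbolicPower_triangleSet
      [![1, 0, 0], ![0, 1, 0], ![0, 0, 1], ![-1, 1, 1], ![1, -1, 1]]
      rfl (by decide) (by decide) not_hasCurve_two
  have h3 : initialDegree (symbolicPower triangleSet 3) = 7 :=
    initialDegree_symbolicPower_triangleSet
      [![1, 0, 0], ![1, 0, 0], ![0, 1, 0], ![0, 0, 1], ![0, 0, 1], ![-1, 1, 1], ![1, 1, -1]]
      rfl (by decide) (by decide) not_hasCurve_three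
  have h4 : initialDegree (symbolicPower triangleSet 4) = 9 :=
    initialDegree_symbolicPower_triangleSet
      [![1, 0, 0], ![1, 0, 0], ![0, 1, 0], ![0, 1, 0], ![0, 0, 1], ![0, 0, 1],
        ![-1, 1, 1], ![1, -1, 1], ![1, 1, -1]]
      rfl (by decide) (by decide) not_hasCurve_four
  refine ⟨triangleSet, Set.finite_range _, not_containedInConic_triangleSet, 1, le_rfl,
    fun k hk hk3 => ?_⟩
  interval_cases k
  · rw [h1, h2]
  · rw [h1, h3]
  · rw [h1, h4]
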